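/- Let C be a finite set, let x be an element with x ∉ C, and let C′ = C ∪ {x} (so C and C′ differ by exactly one node). If A ⊆ C with 2·|A| > |C| and B ⊆ C′ with 2·|B| > |C′|, then A ∩ B is nonempty: any majority of the old configuration and any majority of the new configuration overlap. -/

import Mathlib

/-- Single-node reconfiguration: a majority of the old configuration `C` and a
majority of the new configuration `C′ = C ∪ {x}` always intersect. -/
theorem majorities_intersect_single_node_add {α : Type*} [DecidableEq α]
    (C : Finset α) (x : α) (hx : x ∉ C)
    (C' : Finset α) (hC' : C' = insert x C)
    (A B : Finset α)
    (hA : A ⊆ C) (hAmaj : 2 * A.card > C.card)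
    (hB : B ⊆ C') (hBmaj : 2 * B.card > C'.card) :
    (A ∩ B).Nonempty := by
  have hcard : C'.card = C.card + 1 := by
    rw [hC', Finset.card_insert_of_notMem hx]
  have hAC' : A ⊆ C' := hC' ▸ hA.trans (Finset.subset_insert x C)
  exact Finset.inter_nonempty_of_card_lt_card_add_card hAC' hB (by omega)
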